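/- Let n≥1 and let a_1,…,a_n be positive integers. Then Ehr_{1,1}(F_{K_{n+1}}(a)) = a_n · ∏_{i=1}^{n−1} ((i+1)a_i + a_{i+1} + a_{i+2} + ⋯ + a_n), where K_{n+1} is the complete graph on vertices {0,1,…,n}. -/

import Mathlib

open Finset Polynomial

namespace ThresholdFlow

/-- A threshold graph on `{0,…,n}` labeled by reverse degree sequence: whenever `i > j` are
adjacent and `i' ≤ i`, `j' ≤ j`, `i' ≠ j'`, then `i'` and `j'` are adjacent. -/
def IsThreshold (n : ℕ) (G : SimpleGraph (Fin (n+1))) : Prop :=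
  ∀ i j i' j' : Fin (n+1), j < i → G.Adj i j → i' ≤ i → j' ≤ j → i' ≠ j' → G.Adj i' j'

/-- An integer `a`-flow on `G`: nonnegative integers on the edges of `G` (oriented from the
larger endpoint `i` to the smaller endpoint `j`, recorded as `f i j`), with net flow `a i`
at every vertex `i ≠ 0`. -/
def IsFlow (n : ℕ) (G : SimpleGraph (Fin (n+1))) (a : Fin (n+1) → ℕ)
    (f : Fin (n+1) → Fin (n+1) → ℕ) : Prop :=
  (∀ i j, f i j ≠ 0 → j < i ∧ G.Adj i j) ∧
  (∀ i : Fin (n+1), i ≠ 0 → ∑ j, f i j = a i + ∑ j, f j i)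

/-- The number of positive entries of a flow. -/
def posCount (n : ℕ) (f : Fin (n+1) → Fin (n+1) → ℕ) : ℕ :=
  (Finset.univ.filter fun pr : Fin (n+1) × Fin (n+1) => 0 < f pr.1 pr.2).card

/-- `[b]_q = 1 + q + ⋯ + q^(b-1)` as a polynomial in `ℤ[q]`. -/
noncomputable def qnat (b : ℕ) : Polynomial ℤ := ∑ k ∈ Finset.range b, X ^ k

/-- `Ehr_{q,1}(F_G(a))`: the sum over integer `a`-flows with exactly `n` positive entries of
`∏_{e : f(e) > 0} [f(e)]_q`. -/
noncomputable def Ehr1 (n : ℕ) (G : SimpleGraph (Fin (n+1))) (a : Fin (n+1) → ℕ) :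
    Polynomial ℤ :=
  ∑ᶠ f ∈ {f | IsFlow n G a f ∧ posCount n f = n},
    ∏ i, ∏ j, if 0 < f i j then qnat (f i j) else 1

/-- `Ehr_{q,0}(F_G(a))`: the sum over all integer `a`-flows of
`(q-1)^(s(f)-n) ∏_{e : f(e) > 0} q^(f(e)-1)`. -/
noncomputable def Ehr0 (n : ℕ) (G : SimpleGraph (Fin (n+1))) (a : Fin (n+1) → ℕ) :
    Polynomial ℤ :=
  ∑ᶠ f ∈ {f | IsFlow n G a f},
    (X - 1) ^ (posCount n f - n) * ∏ i, ∏ j, if 0 < f i j then X ^ (f i j - 1) else 1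

/-- `Ehr_{1,1}(F_G(a))`: the sum over integer `a`-flows with exactly `n` positive entries of
the product of the positive entries. -/
noncomputable def Ehr11 (n : ℕ) (G : SimpleGraph (Fin (n+1))) (a : Fin (n+1) → ℕ) : ℕ :=
  ∑ᶠ f ∈ {f | IsFlow n G a f ∧ posCount n f = n},
    ∏ i, ∏ j, if 0 < f i j then f i j else 1

/-- A spanning tree of `G` rooted at `0`, encoded by its parent function `p`:
`p 0 = 0`, each `i ≠ 0` is adjacent in `G` to its parent `p i`, and iterating the parent
function from any vertex reaches the root `0`. -/
def IsSpanTree (n : ℕ) (G : SimpleGraph (Fin (n+1))) (p : Fin (n+1) → Fin (n+1)) : Prop :=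
  p 0 = 0 ∧ (∀ i, i ≠ 0 → G.Adj i (p i)) ∧ ∀ i, ∃ k, p^[k] i = 0

/-- `j` is a descendant of `i` in the rooted tree with parent function `p`
(in particular every vertex is a descendant of itself). -/
def Desc (n : ℕ) (p : Fin (n+1) → Fin (n+1)) (i j : Fin (n+1)) : Prop :=
  ∃ k, p^[k] j = i

/-- The set of inversions of the rooted tree `p`: pairs `(i,j)` with `i > j`, `i ≠ 0` and
`j` a descendant of `i`. -/
def invSet (n : ℕ) (p : Fin (n+1) → Fin (n+1)) : Set (Fin (n+1) × Fin (n+1)) :=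
  {pr | pr.2 < pr.1 ∧ pr.1 ≠ 0 ∧ Desc n p pr.1 pr.2}

/-- The number of inversions of the rooted tree `p`. -/
noncomputable def treeInv (n : ℕ) (p : Fin (n+1) → Fin (n+1)) : ℕ := (invSet n p).ncard

/-- A rooted spanning tree is increasing if it has no inversions. -/
def IsIncr (n : ℕ) (p : Fin (n+1) → Fin (n+1)) : Prop := invSet n p = ∅

/-- `δ_T(i)`: the number of descendants of `i` (including `i` itself). -/
noncomputable def delta (n : ℕ) (p : Fin (n+1) → Fin (n+1)) (i : Fin (n+1)) : ℕ :=
  Set.ncard {j | Desc n p i j}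

/-- `δ_T^a(i) = Σ_j a_j`, summed over the descendants `j` of `i` (including `i` itself). -/
noncomputable def deltaA (n : ℕ) (a : Fin (n+1) → ℕ) (p : Fin (n+1) → Fin (n+1))
    (i : Fin (n+1)) : ℕ :=
  ∑ᶠ j ∈ {j | Desc n p i j}, a j

/-- The degree `d_i` of vertex `i` in `G`. -/
noncomputable def deg (n : ℕ) (G : SimpleGraph (Fin (n+1))) (i : Fin (n+1)) : ℕ :=
  Set.ncard {j | G.Adj i j}

/-- `d̄_i`: the number of neighbors of `i` smaller than `i`. -/
noncomputable def dbar (n : ℕ) (G : SimpleGraph (Fin (n+1))) (i : Fin (n+1)) : ℕ :=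
  Set.ncard {j | j < i ∧ G.Adj i j}

/-- A `G`-parking function, encoded as `P : Fin (n+1) → ℕ` with `P 0 = 0`. -/
def IsParking (n : ℕ) (G : SimpleGraph (Fin (n+1))) (P : Fin (n+1) → ℕ) : Prop :=
  P 0 = 0 ∧ ∀ S : Finset (Fin (n+1)), S.Nonempty → (0 : Fin (n+1)) ∉ S →
    ∃ i ∈ S, P i < Set.ncard {j | j ∉ S ∧ G.Adj i j}

/-- `codeg(P) = (|E(G)| - n) - Σ_{i=1}^n P(i)`. -/
noncomputable def codeg (n : ℕ) (G : SimpleGraph (Fin (n+1))) (P : Fin (n+1) → ℕ) : ℕ :=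
  (Set.ncard G.edgeSet - n) - ∑ i, P i

/-- `[m]_q` as a Laurent polynomial. -/
noncomputable def lq (m : ℕ) : LaurentPolynomial ℤ :=
  ∑ k ∈ Finset.range m, LaurentPolynomial.T (k : ℤ)

/-- `[b]_{q^m} = 1 + q^m + ⋯ + q^{m(b-1)}` as a Laurent polynomial. -/
noncomputable def lqpow (m b : ℕ) : LaurentPolynomial ℤ :=
  ∑ k ∈ Finset.range b, LaurentPolynomial.T ((m : ℤ) * k)

/-- `wt_{q,q⁻¹}(b)`: the substitution `t = q⁻¹` in `wt_{q,t}(b) = Σ_{k=0}^{b-1} q^k t^{b-1-k}`,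
with `wt_{q,q⁻¹}(0) = 1`. -/
noncomputable def wtqq (b : ℕ) : LaurentPolynomial ℤ :=
  if b = 0 then 1 else ∑ k ∈ Finset.range b, LaurentPolynomial.T (2 * (k : ℤ) - ((b : ℤ) - 1))

/-- `Ehr_{q,q⁻¹}(F_G(a))`: the sum over all integer `a`-flows `f` of
`(-(1-q)(1-q⁻¹))^(s(f)-n) ∏_e wt_{q,q⁻¹}(f(e))`, as a Laurent polynomial in `q`. -/
noncomputable def Ehrqq (n : ℕ) (G : SimpleGraph (Fin (n+1))) (a : Fin (n+1) → ℕ) :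
    LaurentPolynomial ℤ :=
  ∑ᶠ f ∈ {f | IsFlow n G a f},
    (-((1 - LaurentPolynomial.T 1) * (1 - LaurentPolynomial.T (-1)))) ^ (posCount n f - n) *
      ∏ i, ∏ j, wtqq (f i j)

end ThresholdFlow

namespace ThresholdFlow

/-- The flows with exactly `n` positive entries. -/
def FS (n : ℕ) (a : Fin (n+1) → ℕ) : Set (Fin (n+1) → Fin (n+1) → ℕ) :=
  {f | IsFlow n ⊤ a f ∧ posCount n f = n}

/-- Product of positive entries. -/
def wt (n : ℕ) (f : Fin (n+1) → Fin (n+1) → ℕ) : ℕ :=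
  ∏ i, ∏ j, if 0 < f i j then f i j else 1

/-- Add a new last vertex with a single out-edge to `j` carrying `x`. -/
def ext (n : ℕ) (x : ℕ) (j : Fin (n+1)) (f : Fin (n+1) → Fin (n+1) → ℕ) :
    Fin (n+2) → Fin (n+2) → ℕ :=
  fun i k => Fin.lastCases (motive := fun _ => ℕ)
    (Fin.lastCases (motive := fun _ => ℕ) 0 (fun k' => if k' = j then x else 0) k)
    (fun i' => Fin.lastCases (motive := fun _ => ℕ) 0 (fun k' => f i' k') k) i

lemma ext_ll (n x j f) : ext n x j f (Fin.last _) (Fin.last _) = 0 := by simp [ext]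
lemma ext_lc (n x j f) (k : Fin (n+1)) :
    ext n x j f (Fin.last _) k.castSucc = if k = j then x else 0 := by simp [ext]
lemma ext_cl (n x j f) (k : Fin (n+1)) : ext n x j f k.castSucc (Fin.last _) = 0 := by simp [ext]
lemma ext_cc (n x j f) (i k : Fin (n+1)) : ext n x j f i.castSucc k.castSucc = f i k := by
  simp [ext]

lemma wt_ext (n x j f) (hx : 0 < x) : wt (n+1) (ext n x j f) = x * wt n f := by
  unfold wt
  rw [Fin.prod_univ_castSucc]
  simp only [Fin.prod_univ_castSucc (n := n+1), ext_ll, ext_lc, ext_cl, ext_cc]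
  simp only [lt_irrefl, if_false, mul_one]
  rw [mul_comm]
  congr 1
  rw [Finset.prod_eq_single j]
  · simp [hx]
  · intro b _ hb; simp [hb]
  · simp

lemma posCount_eq (n f) : posCount n f = ∑ i, ∑ j, if 0 < f i j then 1 else 0 := by
  unfold posCount
  rw [Finset.card_filter, Fintype.sum_prod_type]

lemma posCount_succ (n) (f : Fin (n+2) → Fin (n+2) → ℕ) (h : ∀ i, f i (Fin.last _) = 0) :
    posCount (n+1) f = posCount n (fun i k => f i.castSucc k.castSucc) +
      ∑ k : Fin (n+1), if 0 < f (Fin.last _) k.castSucc then 1 else 0 := by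
  simp only [posCount_eq]
  rw [Fin.sum_univ_castSucc]
  simp only [Fin.sum_univ_castSucc (n := n+1), h, lt_irrefl, if_false, add_zero]

/-- Each nonroot vertex has an outgoing edge. -/
lemma row_pos (n) (a : Fin (n+1) → ℕ) (ha : ∀ i, i ≠ 0 → 0 < a i) (f) (hf : IsFlow n ⊤ a f)
    (i) (hi : i ≠ 0) : 1 ≤ ∑ j, if 0 < f i j then 1 else 0 := by
  have h := hf.2 i hi
  have h2 : 0 < ∑ j, f i j := by have := ha i hi; omega
  obtain ⟨j, hj, hj2⟩ := Finset.exists_ne_zero_of_sum_ne_zero h2.ne'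
  rw [Nat.succ_le_iff]
  refine Finset.sum_pos' (fun _ _ => Nat.zero_le _) ⟨j, hj, ?_⟩
  simp [Nat.pos_of_ne_zero hj2]

lemma posCount_ge (n) (a : Fin (n+1) → ℕ) (ha : ∀ i, i ≠ 0 → 0 < a i) (f)
    (hf : IsFlow n ⊤ a f) : n ≤ posCount n f := by
  rw [posCount_eq, Fin.sum_univ_succ]
  calc n = ∑ i : Fin n, 1 := by simp
    _ ≤ ∑ i : Fin n, ∑ j, if 0 < f i.succ j then 1 else 0 :=
      Finset.sum_le_sum fun i _ => row_pos n a ha f hf i.succ (Fin.succ_ne_zero i)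
    _ ≤ _ := Nat.le_add_left _ _

/-- New net flow after removal of the last vertex. -/
def red (n : ℕ) (a : Fin (n+2) → ℕ) (j : Fin (n+1)) : Fin (n+1) → ℕ :=
  fun i => a i.castSucc + if i = j then a (Fin.last _) else 0

lemma isFlow_iff (n) (a : Fin (n+2) → ℕ) (j f) (hx : 0 < a (Fin.last _)) :
    IsFlow (n+1) ⊤ a (ext n (a (Fin.last _)) j f) ↔ IsFlow n ⊤ (red n a j) f := by
  unfold IsFlow
  apply and_congr
  · constructor
    · intro h i k hik
      have := h i.castSucc k.castSucc (by rwa [ext_cc])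
      simpa using this
    · intro h i k
      induction i using Fin.lastCases with
      | last =>
        induction k using Fin.lastCases with
        | last => simp [ext_ll]
        | cast k => intro _; simp [Fin.castSucc_lt_last, (Fin.castSucc_lt_last k).ne']
      | cast i =>
        induction k using Fin.lastCases with
        | last => simp [ext_cl]
        | cast k => rw [ext_cc]; intro hh; simpa using h i k hh
  · constructor
    · intro h i hi
      have := h i.castSucc (by simpa using hi)
      simp only [Fin.sum_univ_castSucc (n := n+1), ext_lc, ext_cl, ext_cc] at this
      unfold red
      omega
    · intro h i
      induction i using Fin.lastCases with
      | last =>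
        intro _
        simp [Fin.sum_univ_castSucc (n := n+1), ext_lc, ext_cl, ext_ll]
      | cast i =>
        intro hi
        have := h i (by simpa using hi)
        simp only [Fin.sum_univ_castSucc (n := n+1), ext_lc, ext_cl, ext_cc]
        unfold red at this
        omega

lemma FS_succ (n) (a : Fin (n+2) → ℕ) (ha : ∀ i, i ≠ 0 → 0 < a i) :
    FS (n+1) a = ⋃ j : Fin (n+1), ext n (a (Fin.last _)) j '' FS n (red n a j) := by
  have hx : 0 < a (Fin.last _) := ha _ (Fin.last_pos.ne')
  have hred : ∀ j, ∀ i, i ≠ 0 → 0 < red n a j i := by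
    intro j i hi
    have := ha i.castSucc (by simpa using hi)
    unfold red; omega
  have hpe : ∀ j f, posCount (n+1) (ext n (a (Fin.last _)) j f) = posCount n f + 1 := by
    intro j f
    rw [posCount_succ]
    · simp only [ext_cc, ext_lc]
      congr 1
      rw [Finset.sum_eq_single j]
      · simp [hx]
      · intro b _ hb; simp [hb]
      · simp
    · intro i
      induction i using Fin.lastCases with
      | last => exact ext_ll ..
      | cast i => exact ext_cl ..
  ext f
  simp only [Set.mem_iUnion, Set.mem_image]
  constructor
  · rintro ⟨hf, hc⟩
    have hlast : ∀ i, f i (Fin.last _) = 0 := by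
      intro i
      by_contra h
      exact absurd (hf.1 i _ h).1 (not_lt.2 (Fin.le_last i))
    have hrow := row_pos (n+1) a ha f hf (Fin.last _) (Fin.last_pos.ne')
    have hle : (∑ j, if 0 < f (Fin.last _) j then 1 else 0) ≤ 1 := by
      rw [posCount_eq, Fin.sum_univ_succ] at hc
      have hs : Fin.last (n+1) = (Fin.last n).succ := rfl
      rw [hs]
      have h1 : ∀ i : Fin (n+1), 1 ≤ ∑ j, if 0 < f i.succ j then 1 else 0 := fun i =>
        row_pos (n+1) a ha f hf i.succ (Fin.succ_ne_zero i)
      rw [Fin.sum_univ_castSucc (fun i : Fin (n+1) => ∑ j, if 0 < f i.succ j then 1 else 0)] at hc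
      have h2 : n ≤ ∑ i : Fin n, ∑ j, if 0 < f i.castSucc.succ j then 1 else 0 := by
        calc n = ∑ i : Fin n, 1 := by simp
          _ ≤ _ := Finset.sum_le_sum fun i _ => h1 i.castSucc
      omega
    have hone : (∑ j, if 0 < f (Fin.last _) j then 1 else 0) = 1 := le_antisymm hle hrow
    rw [← Finset.card_filter, Finset.card_eq_one] at hone
    obtain ⟨j, hj⟩ := hone
    have hj' : ∀ k, 0 < f (Fin.last _) k ↔ k = j := by
      intro k
      have := Finset.ext_iff.1 hj k
      simpa using this
    have hjl : j ≠ Fin.last _ := by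
      intro h
      have := (hj' j).2 rfl
      rw [h, hlast] at this
      exact lt_irrefl _ this
    obtain ⟨j, rfl⟩ := Fin.exists_castSucc_eq.2 hjl
    have hval : f (Fin.last _) j.castSucc = a (Fin.last _) := by
      have h := hf.2 (Fin.last _) (Fin.last_pos.ne')
      simp only [hlast, Finset.sum_const_zero, add_zero] at h
      rw [← h, Finset.sum_eq_single j.castSucc]
      · intro b _ hb
        have := mt (hj' b).1 hb
        omega
      · simp
    have hfe : ext n (a (Fin.last _)) j (fun i k => f i.castSucc k.castSucc) = f := by
      funext i k
      induction i using Fin.lastCases with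
      | last =>
        induction k using Fin.lastCases with
        | last => rw [ext_ll, hlast]
        | cast k =>
          rw [ext_lc]
          split_ifs with h
          · rw [h, hval]
          · have := mt (hj' k.castSucc).1 (by simpa using h)
            omega
      | cast i =>
        induction k using Fin.lastCases with
        | last => rw [ext_cl, hlast]
        | cast k => rw [ext_cc]
    refine ⟨j, _, ⟨?_, ?_⟩, hfe⟩
    · rw [← isFlow_iff n a j _ hx, hfe]; exact hf
    · have := hpe j (fun i k => f i.castSucc k.castSucc)
      rw [hfe, hc] at this
      omega
  · rintro ⟨j, g, ⟨hg, hc⟩, rfl⟩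
    exact ⟨(isFlow_iff n a j g hx).2 hg, by rw [hpe, hc]⟩

lemma ext_inj (n x j) : Function.Injective (ext n x j) := by
  intro f g h
  funext i k
  rw [← ext_cc n x j f, h, ext_cc]

lemma FS_zero (a : Fin 1 → ℕ) : FS 0 a = {fun _ _ => 0} := by
  ext f
  simp only [Set.mem_singleton_iff]
  constructor
  · rintro ⟨hf, _⟩
    funext i k
    by_contra h
    exact absurd (hf.1 i k h).1 (by simp [Fin.fin_one_eq_zero i, Fin.fin_one_eq_zero k])
  · rintro rfl
    refine ⟨⟨by simp, fun i hi => absurd (Fin.fin_one_eq_zero i) hi⟩, by simp [posCount]⟩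

lemma red_pos (n) (a : Fin (n+2) → ℕ) (ha : ∀ i, i ≠ 0 → 0 < a i) (j) :
    ∀ i, i ≠ 0 → 0 < red n a j i := by
  intro i hi
  have := ha i.castSucc (by simpa using hi)
  unfold red; omega

lemma FS_finite (n) : ∀ (a : Fin (n+1) → ℕ), (∀ i, i ≠ 0 → 0 < a i) → (FS n a).Finite := by
  induction n with
  | zero => intro a _; rw [FS_zero]; exact Set.finite_singleton _
  | succ n ih =>
    intro a ha
    rw [FS_succ n a ha]
    exact Set.finite_iUnion fun j => (ih _ (red_pos n a ha j)).image _

lemma Ehr11_def (n a) : Ehr11 n ⊤ a = ∑ᶠ f ∈ FS n a, wt n f := rfl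

lemma Ehr11_zero (a) : Ehr11 0 ⊤ a = 1 := by
  rw [Ehr11_def, FS_zero, finsum_mem_singleton]
  simp [wt]

lemma Ehr11_succ (n) (a : Fin (n+2) → ℕ) (ha : ∀ i, i ≠ 0 → 0 < a i) :
    Ehr11 (n+1) ⊤ a = a (Fin.last _) * ∑ j, Ehr11 n ⊤ (red n a j) := by
  have hx : 0 < a (Fin.last _) := ha _ (Fin.last_pos.ne')
  rw [Ehr11_def, FS_succ n a ha, finsum_mem_iUnion]
  · rw [finsum_eq_sum_of_fintype, Finset.mul_sum]
    refine Finset.sum_congr rfl fun j _ => ?_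
    rw [finsum_mem_image (ext_inj _ _ _).injOn, Ehr11_def]
    simp only [wt_ext _ _ _ _ hx]
    rw [finsum_mem_eq_finite_toFinset_sum _ (FS_finite n _ (red_pos n a ha j)),
      finsum_mem_eq_finite_toFinset_sum _ (FS_finite n _ (red_pos n a ha j)), Finset.mul_sum]
  · intro j k hjk
    refine Set.disjoint_left.2 ?_
    rintro _ ⟨f, _, rfl⟩ ⟨g, _, h⟩
    have := congrFun (congrFun h (Fin.last _)) j.castSucc
    rw [ext_lc, ext_lc, if_neg hjk, if_pos rfl] at this
    omega
  · exact fun j => (FS_finite n _ (red_pos n a ha j)).image _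

lemma telescope (b : ℕ → ℕ) (x k : ℕ) :
    ∏ i ∈ range k, b i + ∑ j ∈ range k, ∏ i ∈ range k,
      (b i + (if i < j then x else if i = j then (i+2)*x else 0)) =
    (k+1) * ∏ i ∈ range k, (b i + x) := by
  induction k with
  | zero => simp
  | succ k ih =>
    rw [Finset.sum_range_succ]
    have h1 : ∑ j ∈ range k, ∏ i ∈ range (k+1),
        (b i + (if i < j then x else if i = j then (i+2)*x else 0)) =
        (∑ j ∈ range k, ∏ i ∈ range k,
          (b i + (if i < j then x else if i = j then (i+2)*x else 0))) * b k := by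
      rw [Finset.sum_mul]
      refine Finset.sum_congr rfl fun j hj => ?_
      have := Finset.mem_range.1 hj
      rw [Finset.prod_range_succ, if_neg (by omega), if_neg (by omega), add_zero]
    have h2 : ∏ i ∈ range (k+1), (b i + (if i < k then x else if i = k then (i+2)*x else 0)) =
        (∏ i ∈ range k, (b i + x)) * (b k + (k+2)*x) := by
      rw [Finset.prod_range_succ]
      simp only [lt_irrefl, if_false, if_true]
      congr 1
      refine Finset.prod_congr rfl fun i hi => ?_
      rw [if_pos (Finset.mem_range.1 hi)]
    rw [h1, h2, Finset.prod_range_succ, Finset.prod_range_succ, ← add_assoc, ← add_mul, ih]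
    ring

lemma main_nat (n : ℕ) : ∀ A : ℕ → ℕ, (∀ i, i ≠ 0 → 0 < A i) →
    Ehr11 (n+1) ⊤ (fun i => A i) = A (n+1) *
      ∏ i ∈ range n, ((i+2) * A (i+1) + ∑ k ∈ Ico (i+2) (n+2), A k) := by
  induction n with
  | zero =>
    intro A hA
    rw [Ehr11_succ _ _ (fun i hi => hA _ (fun h => hi (Fin.ext h)))]
    simp [Ehr11_zero]
  | succ n ih =>
    intro A hA
    rw [Ehr11_succ _ _ (fun i hi => hA _ (fun h => hi (Fin.ext h)))]
    simp only [Fin.val_last]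
    congr 1
    set x := A (n+1+1) with hxdef
    have hr : ∀ j : Fin (n+2), red (n+1) (fun i => A i) j =
        fun i : Fin (n+2) => (fun k : ℕ => A k + if k = (j : ℕ) then x else 0) i := by
      intro j
      funext i
      simp [red, Fin.ext_iff, hxdef]
    simp only [hr]
    have hE : ∀ j : ℕ, Ehr11 (n+1) ⊤
        (fun i : Fin (n+2) => (fun k : ℕ => A k + if k = j then x else 0) i) = _ := fun j =>
      ih (fun k : ℕ => A k + if k = j then x else 0)
        (fun i hi => Nat.add_pos_left (hA i hi) _)
    simp only [hE]
    rw [Fin.sum_univ_eq_sum_range (fun j => (A (n+1) + if n+1 = j then x else 0) *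
      ∏ i ∈ range n, ((i+2) * (A (i+1) + if i+1 = j then x else 0) +
        ∑ k ∈ Ico (i+2) (n+2), (A k + if k = j then x else 0)))]
    rw [Finset.sum_range_succ, Finset.sum_range_succ']
    set b : ℕ → ℕ := fun i => (i+2) * A (i+1) + ∑ k ∈ Ico (i+2) (n+2), A k with hb
    have hfac : ∀ i j, j ≤ n → i < n →
        (i+2) * (A (i+1) + if i+1 = j+1 then x else 0) +
        ∑ k ∈ Ico (i+2) (n+2), (A k + if k = j+1 then x else 0) =
        b i + (if i < j then x else if i = j then (i+2)*x else 0) := by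
      intro i j hj hi
      rw [Finset.sum_add_distrib, Finset.sum_ite_eq']
      simp only [Finset.mem_Ico, hb]
      rcases lt_trichotomy i j with h | h | h
      · rw [if_neg (by omega), if_pos (by omega), if_pos h]; ring
      · rw [if_pos (by omega), if_neg (by omega), if_neg (by omega), if_pos h]; ring
      · rw [if_neg (by omega), if_neg (by omega), if_neg (by omega), if_neg (by omega)]; ring
    have hfac0 : ∀ i, (i+2) * (A (i+1) + if i+1 = 0 then x else 0) +
        ∑ k ∈ Ico (i+2) (n+2), (A k + if k = 0 then x else 0) = b i := by
      intro i
      rw [Finset.sum_add_distrib, Finset.sum_ite_eq']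
      simp [hb]
    have e1 : ∀ j ∈ range n, (A (n+1) + if n+1 = j+1 then x else 0) *
      ∏ i ∈ range n, ((i+2) * (A (i+1) + if i+1 = j+1 then x else 0) +
        ∑ k ∈ Ico (i+2) (n+2), (A k + if k = j+1 then x else 0)) =
      A (n+1) * ∏ i ∈ range n, (b i + (if i < j then x else if i = j then (i+2)*x else 0)) := by
      intro j hj
      have hj := Finset.mem_range.1 hj
      rw [if_neg (by omega), add_zero]
      congr 1
      exact Finset.prod_congr rfl fun i hi => hfac i j hj.le (Finset.mem_range.1 hi)
    have e2 : ∏ i ∈ range n, ((i+2) * (A (i+1) + if i+1 = n+1 then x else 0) +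
        ∑ k ∈ Ico (i+2) (n+2), (A k + if k = n+1 then x else 0)) =
        ∏ i ∈ range n, (b i + x) := by
      refine Finset.prod_congr rfl fun i hi => ?_
      rw [hfac i n le_rfl (Finset.mem_range.1 hi), if_pos (Finset.mem_range.1 hi)]
    rw [Finset.sum_congr rfl e1, e2, Finset.prod_congr rfl (fun i _ => hfac0 i),
      ← Finset.mul_sum, if_pos rfl, if_neg (by omega), add_zero, Finset.prod_range_succ]
    have e3 : ∏ i ∈ range n, ((i+2) * A (i+1) + ∑ k ∈ Ico (i+2) (n+1+2), A k) =
        ∏ i ∈ range n, (b i + x) := by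
      refine Finset.prod_congr rfl fun i hi => ?_
      have := Finset.mem_range.1 hi
      rw [show n+1+2 = (n+2)+1 by omega, Finset.sum_Ico_succ_top (by omega), ← add_assoc]
    have e4 : ∑ k ∈ Ico (n+2) (n+1+2), A k = x := by
      rw [show n+1+2 = (n+2)+1 by omega, Finset.sum_Ico_succ_top (by omega)]
      simp [hxdef]
    rw [e3, e4, ← mul_add, add_comm (∑ j ∈ range n, _), telescope]
    ring

theorem ehr_11_complete (n : ℕ) (hn : 1 ≤ n) (a : Fin (n+1) → ℕ)
    (ha : ∀ i : Fin (n+1), i ≠ 0 → 0 < a i) :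
    Ehr11 n ⊤ a =
      a (Fin.last n) *
        ∏ i ∈ Finset.univ.filter (fun i : Fin (n+1) => 0 < (i : ℕ) ∧ (i : ℕ) < n),
          (((i : ℕ) + 1) * a i + ∑ j : Fin (n+1), if i < j then a j else 0) := by
  obtain ⟨m, rfl⟩ : ∃ m, n = m + 1 := ⟨n - 1, by omega⟩
  set A : ℕ → ℕ := fun k => if h : k < m + 1 + 1 then a ⟨k, h⟩ else 1 with hA
  have hAa : ∀ i : Fin (m+1+1), A i = a i := by intro i; simp only [hA]; rw [dif_pos i.isLt]
  have hpos : ∀ i, i ≠ 0 → 0 < A i := by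
    intro i hi
    simp only [hA]
    split_ifs with h
    · exact ha _ (by simpa [Fin.ext_iff] using hi)
    · exact one_pos
  have hmain := main_nat m A hpos
  simp only [hAa] at hmain
  rw [hmain, ← hAa (Fin.last _), Fin.val_last]
  congr 1
  symm
  have hsum : ∀ i : Fin (m+1+1), (∑ j : Fin (m+1+1), if i < j then a j else 0) =
      ∑ k ∈ Ico ((i : ℕ)+1) (m+2), A k := by
    intro i
    have h0 : (∑ j : Fin (m+1+1), if i < j then a j else 0) =
        ∑ j : Fin (m+1+1), (fun k : ℕ => if (i : ℕ) < k then A k else 0) j := by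
      refine Finset.sum_congr rfl fun j _ => ?_
      simp only [hAa, Fin.lt_def]
    rw [h0, Fin.sum_univ_eq_sum_range (fun k : ℕ => if (i : ℕ) < k then A k else 0),
      ← Finset.sum_filter]
    refine Finset.sum_congr ?_ fun _ _ => rfl
    ext k
    simp only [Finset.mem_filter, Finset.mem_range, Finset.mem_Ico]
    omega
  rw [Finset.prod_filter]
  have h1 : ∀ i : Fin (m+1+1), (if 0 < (i : ℕ) ∧ (i : ℕ) < m+1 then
      (((i : ℕ) + 1) * a i + ∑ j : Fin (m+1+1), if i < j then a j else 0) else 1) =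
      (fun k : ℕ => if 0 < k ∧ k < m+1 then (k+1) * A k + ∑ l ∈ Ico (k+1) (m+2), A l else 1) i := by
    intro i
    simp only [hsum, hAa]
  rw [Finset.prod_congr rfl (fun i _ => h1 i), Fin.prod_univ_eq_prod_range
    (fun k : ℕ => if 0 < k ∧ k < m+1 then (k+1) * A k + ∑ l ∈ Ico (k+1) (m+2), A l else 1),
    Finset.prod_range_succ, Finset.prod_range_succ', if_neg (by omega), if_neg (by omega),
    mul_one, mul_one]
  refine Finset.prod_congr rfl fun i hi => ?_
  have := Finset.mem_range.1 hi
  rw [if_pos (by omega)]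

end ThresholdFlow
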